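/- In the Setup, for any piece P of the tree-graded space X, on P \ {x_P} the coloring c*_X differs from c_P by a constant modulo n+1: either c*_X(y) = c_P(y) + c*_X(x_P) (mod n+1) for all y ∈ P \ {x_P}, or c*_X(y) = c_P(y) + c*_X(x_P) + 1 (mod n+1) for all y ∈ P \ {x_P}. In particular, in any piece P all r-components of each c*_X-color class are 8·f(r)-bounded. -/

import Mathlib

open Set Metric

section Core

variable {X : Type*} [MetricSpace X]

/-- A geodesic segment parametrized by the interval `[a, b]`:
an isometric embedding of `[a, b]` into `X`. -/
def IsGeodesicSegment (γ : ℝ → X) (a b : ℝ) : Prop :=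
  ∀ s ∈ Set.Icc a b, ∀ t ∈ Set.Icc a b, dist (γ s) (γ t) = |s - t|

/-- A metric space is geodesic if every two points are joined by a geodesic. -/
def GeodesicSpace (X : Type*) [MetricSpace X] : Prop :=
  ∀ x y : X, ∃ γ : ℝ → X, IsGeodesicSegment γ 0 (dist x y) ∧ γ 0 = x ∧ γ (dist x y) = y

/-- A subset is geodesic if every two of its points are joined by a geodesic of `X`
contained in the subset. -/
def IsGeodesicSubset (S : Set X) : Prop :=
  ∀ x ∈ S, ∀ y ∈ S, ∃ γ : ℝ → X, IsGeodesicSegment γ 0 (dist x y) ∧ γ 0 = x ∧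
    γ (dist x y) = y ∧ ∀ t ∈ Set.Icc (0 : ℝ) (dist x y), γ t ∈ S

/-- A (complete geodesic) metric space is tree-graded with respect to a collection `PX`
of closed geodesic subsets (pieces) covering `X` if every two different pieces meet in
at most one point (T₁) and every simple loop (injective continuous image of a circle)
is contained in one piece (T₂''). -/
structure IsTreeGraded (X : Type*) [MetricSpace X] (PX : Set (Set X)) : Prop where
  nonempty : ∀ P ∈ PX, P.Nonempty
  closed : ∀ P ∈ PX, IsClosed P
  geodesicSub : ∀ P ∈ PX, IsGeodesicSubset P
  covers : ∀ x : X, ∃ P ∈ PX, x ∈ P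
  t1 : ∀ P ∈ PX, ∀ Q ∈ PX, P ≠ Q → (P ∩ Q).Subsingleton
  t2 : ∀ loop : AddCircle (1 : ℝ) → X, Continuous loop → Function.Injective loop →
    ∃ P ∈ PX, Set.range loop ⊆ P

end Core
section Chains

variable {Y : Type*}

/-- An `r`-chain from `x` to `y` inside the set `S`, with respect to the distance
function `d`: a finite sequence `x = c 0, c 1, …, c m = y` of points of `S` with
consecutive distances `< r`. -/
def IsDChain (d : Y → Y → ℝ) (r : ℝ) (S : Set Y) (x y : Y) : Prop :=
  ∃ (m : ℕ) (c : ℕ → Y), c 0 = x ∧ c m = y ∧ (∀ i ≤ m, c i ∈ S) ∧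
    ∀ i < m, d (c i) (c (i + 1)) < r

/-- A set is `r`-scale connected if every two of its points are joined by an
`r`-chain contained in it. -/
def DScaleConnected (d : Y → Y → ℝ) (r : ℝ) (S : Set Y) : Prop :=
  ∀ x ∈ S, ∀ y ∈ S, IsDChain d r S x y

/-- `C` is an `r`-scale connected component of `U`: a maximal `r`-scale connected
subset of `U`. -/
def IsDComponent (d : Y → Y → ℝ) (r : ℝ) (U C : Set Y) : Prop :=
  C ⊆ U ∧ DScaleConnected d r C ∧
    ∀ C', C ⊆ C' → C' ⊆ U → DScaleConnected d r C' → C = C'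

/-- A set is `M`-bounded: its diameter is at most `M`. -/
def DBounded (d : Y → Y → ℝ) (M : ℝ) (S : Set Y) : Prop :=
  ∀ x ∈ S, ∀ y ∈ S, d x y ≤ M

/-- A space has dimension `≤ n` at scale `s` of magnitude `M` if there is a cover by
`n + 1` sets such that every `s`-scale connected component of each of them is
`M`-bounded. -/
def DimLeAtScale (d : Y → Y → ℝ) (n : ℕ) (s M : ℝ) : Prop :=
  ∃ U : Fin (n + 1) → Set Y, (∀ y, ∃ i, y ∈ U i) ∧
    ∀ i C, IsDComponent d s (U i) C → DBounded d M C

end Chains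
section TreeGradedColoring

variable {X : Type*} [MetricSpace X]

/-- The `r`-scale connected component `𝔠_P` of `c_P`-color `0` of the piece `P`
containing its base point `x_P = proj P x̂`: the set of points of `P` reachable from
`x_P` by an `r`-chain of points of `P` of `c_P`-color `0`. -/
def pieceComp (r : ℝ) {n : ℕ} (xhat : X) (proj : Set X → X → X)
    (cP : Set X → X → Fin (n + 1)) (P : Set X) : Set X :=
  {y | IsDChain dist r {z | z ∈ P ∧ cP P z = 0} (proj P xhat) y}

/-- `P` is a long piece of the geodesic `γ : [0, L] → X` (from `x̂` to `x = γ L`):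
`γ` meets `P` and the exit point `π_P x` does not belong to `𝔠_P`. -/
def IsLongPiece (PX : Set (Set X)) (r : ℝ) {n : ℕ} (xhat : X)
    (proj : Set X → X → X) (cP : Set X → X → Fin (n + 1))
    (γ : ℝ → X) (L : ℝ) (P : Set X) : Prop :=
  P ∈ PX ∧ (∃ t ∈ Set.Icc 0 L, γ t ∈ P) ∧
    proj P (γ L) ∉ pieceComp r xhat proj cP P

/-- The parameter at which the geodesic `γ : [0, L] → X` enters the piece `P`. -/
noncomputable def pieceStart (γ : ℝ → X) (L : ℝ) (P : Set X) : ℝ :=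
  sInf {t | t ∈ Set.Icc 0 L ∧ γ t ∈ P}

/-- The parameter at which the geodesic `γ : [0, L] → X` exits the piece `P`. -/
noncomputable def pieceEnd (γ : ℝ → X) (L : ℝ) (P : Set X) : ℝ :=
  sSup {t | t ∈ Set.Icc 0 L ∧ γ t ∈ P}

/-- The complement in `γ : [0, L] → X` (in parameter space) of the interiors of all
reduced long pieces of `γ`; its connected components are the subpaths `β₁, …, β_k`. -/
noncomputable def betaSet (PX : Set (Set X)) (r : ℝ) {n : ℕ} (xhat : X)
    (proj : Set X → X → X) (cP : Set X → X → Fin (n + 1))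
    (γ : ℝ → X) (L : ℝ) : Set ℝ :=
  Set.Icc 0 L \
    ⋃ P ∈ {P | IsLongPiece PX r xhat proj cP γ L P},
      Set.Ioo (pieceStart γ L P + r / 2) (pieceEnd γ L P)

/-- The length `|⌊β⌋|` of the initial part of the subpath `β = γ|[a,b]`, where
`⌊β⌋` goes from `β₋ = γ a` to the entry point `β′` of the piece of the induced
tree-graded structure on `β` containing `β₊ = γ b`. -/
noncomputable def floorLen (PX : Set (Set X)) (γ : ℝ → X) (a b : ℝ) : ℝ :=
  sInf {t | t ∈ Set.Icc a b ∧ ∃ P ∈ PX, γ '' Set.Icc t b ⊆ P} - a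

/-- `v` is the value at `x = γ L` of the coloring `c*_X` computed along the geodesic
`γ : [0, L] → X` from `x̂` to `x`:
`v = Σ_P c_P(π_P x) + Σᵢ ⌊ |⌊βᵢ⌋| / (99 f(r)) ⌋ (mod n+1)`,
where the first sum is over the (finitely many) pieces with a nonzero term and
`β₁, …, β_k` are the connected components of the complement in `γ` of the interiors
of the reduced long pieces of `γ`. -/
def ColorValue (PX : Set (Set X)) (r fr : ℝ) {n : ℕ} (xhat : X)
    (proj : Set X → X → X) (cP : Set X → X → Fin (n + 1))
    (γ : ℝ → X) (L : ℝ) (v : Fin (n + 1)) : Prop :=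
  ∃ (Ps : Finset (Set X)) (k : ℕ) (a b : Fin k → ℝ),
    (↑Ps : Set (Set X)) = {P | P ∈ PX ∧ cP P (proj P (γ L)) ≠ 0} ∧
    (∀ i, a i ≤ b i) ∧
    (betaSet PX r xhat proj cP γ L = ⋃ i, Set.Icc (a i) (b i)) ∧
    (∀ i j, i ≠ j → b i < a j ∨ b j < a i) ∧
    (v : ℕ) =
      ((Ps.sum fun P => ((cP P (proj P (γ L)) : ℕ))) +
        (Finset.univ.sum fun i : Fin k =>
          Nat.floor (floorLen PX γ (a i) (b i) / (99 * fr)))) % (n + 1)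

/-- The Setup: `X` is a geodesic metric space, tree-graded with respect to `PX`, pieces
do not contain other pieces; `n` is a positive integer, `r > 0` and `f(r) ≥ r`;
`proj P` is the nearest-point projection onto the piece `P`; `x̂` is a base point and
`x_P = proj P x̂`; `c_P` is a coloring of each piece `P` by `n + 1` colors such that
`r`-components of every nonzero color are `f(r)`-bounded, `r`-components of color `0`
are `8 f(r)`-bounded, and `c_P` vanishes on the closed ball `B(x_P, 2r)`. -/
structure ColoringSetup (X : Type*) [MetricSpace X] (PX : Set (Set X)) (n : ℕ)
    (r fr : ℝ) (xhat : X) (proj : Set X → X → X)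
    (cP : Set X → X → Fin (n + 1)) : Prop where
  geodesic : GeodesicSpace X
  treeGraded : IsTreeGraded X PX
  noPieceContainsPiece : ∀ P ∈ PX, ∀ Q ∈ PX, P ⊆ Q → P = Q
  npos : 0 < n
  rpos : 0 < r
  rlefr : r ≤ fr
  projMem : ∀ P ∈ PX, ∀ x : X, proj P x ∈ P
  projDist : ∀ P ∈ PX, ∀ x : X, dist x (proj P x) = Metric.infDist x P
  ballZero : ∀ P ∈ PX, ∀ y ∈ P, dist y (proj P xhat) ≤ 2 * r → cP P y = 0
  nonzeroBounded : ∀ P ∈ PX, ∀ j : Fin (n + 1), j ≠ 0 →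
    ∀ x y : X, IsDChain dist r {z | z ∈ P ∧ cP P z = j} x y → dist x y ≤ fr
  zeroBounded : ∀ P ∈ PX, ∀ x y : X,
    IsDChain dist r {z | z ∈ P ∧ cP P z = 0} x y → dist x y ≤ 8 * fr

end TreeGradedColoring
section TreeGradedGeometry

variable {X : Type*} [MetricSpace X]

theorem IsGeodesicSegment.continuousOn {γ : ℝ → X} {a b : ℝ} (h : IsGeodesicSegment γ a b) :
    ContinuousOn γ (Icc a b) := by
  have : LipschitzOnWith 1 γ (Icc a b) := LipschitzOnWith.of_dist_le_mul fun s hs t ht => by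
    simp [h s hs t ht, Real.dist_eq]
  exact this.continuousOn

theorem IsGeodesicSegment.injOn {γ : ℝ → X} {a b : ℝ} (h : IsGeodesicSegment γ a b) :
    InjOn γ (Icc a b) := by
  intro s hs t ht hst
  have := h s hs t ht
  rw [hst, dist_self] at this
  linarith [abs_eq_zero.1 this.symm]

theorem IsGeodesicSegment.mono {γ : ℝ → X} {a b c d : ℝ} (h : IsGeodesicSegment γ a b)
    (hac : a ≤ c) (hdb : d ≤ b) : IsGeodesicSegment γ c d :=
  fun s hs t ht => h s ⟨hac.trans hs.1, hs.2.trans hdb⟩ t ⟨hac.trans ht.1, ht.2.trans hdb⟩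

/-- The distance along a geodesic from its starting point. -/
theorem IsGeodesicSegment.dist_zero {γ : ℝ → X} {L t : ℝ} (h : IsGeodesicSegment γ 0 L)
    (ht : t ∈ Icc 0 L) : dist (γ 0) (γ t) = t := by
  rw [h 0 ⟨le_rfl, ht.1.trans ht.2⟩ t ht, zero_sub, abs_neg, abs_of_nonneg ht.1]

/-- The path following `γ` up to time `l` and `σ` afterwards. -/
noncomputable def pathConcat {Y : Type*} (γ : ℝ → Y) (l : ℝ) (σ : ℝ → Y) (t : ℝ) : Y :=
  if t ≤ l then γ t else σ (t - l)

theorem pathConcat_of_le {Y : Type*} {γ σ : ℝ → Y} {l t : ℝ} (h : t ≤ l) : pathConcat γ l σ t = γ t :=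
  if_pos h

theorem pathConcat_of_ge {Y : Type*} {γ σ : ℝ → Y} {l t : ℝ} (hl : γ l = σ 0) (h : l ≤ t) :
    pathConcat γ l σ t = σ (t - l) := by
  rcases h.eq_or_lt with rfl | h
  · rw [pathConcat_of_le le_rfl, sub_self, hl]
  · exact if_neg h.not_ge

theorem pathConcat_continuousOn {γ σ : ℝ → X} {a l D : ℝ} (hl : γ l = σ 0)
    (hγ : ContinuousOn γ (Icc a l)) (hσ : ContinuousOn σ (Icc 0 D)) :
    ContinuousOn (pathConcat γ l σ) (Icc a (l + D)) := by
  have h1 : ContinuousOn (pathConcat γ l σ) (Icc a l) :=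
    hγ.congr fun t ht => pathConcat_of_le ht.2
  have h2 : ContinuousOn (pathConcat γ l σ) (Icc l (l + D)) := by
    have : ContinuousOn (fun t => σ (t - l)) (Icc l (l + D)) :=
      hσ.comp (by fun_prop) fun t ht => ⟨by linarith [ht.1], by linarith [ht.2]⟩
    exact this.congr fun t ht => pathConcat_of_ge hl ht.1
  refine (h1.union_of_isClosed h2 isClosed_Icc isClosed_Icc).mono fun t ht => ?_
  rcases le_total t l with h | h
  · exact Or.inl ⟨ht.1, h⟩
  · exact Or.inr ⟨h, ht.2⟩

/-- A concatenation of geodesics whose endpoints are at the maximal distance is a geodesic. -/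
theorem IsGeodesicSegment.concat {γ σ : ℝ → X} {l D : ℝ} (hl0 : 0 ≤ l) (hD : 0 ≤ D)
    (hγ : IsGeodesicSegment γ 0 l) (hσ : IsGeodesicSegment σ 0 D) (hl : γ l = σ 0)
    (hdist : l + D ≤ dist (γ 0) (σ D)) : IsGeodesicSegment (pathConcat γ l σ) 0 (l + D) := by
  have cross : ∀ s ∈ Icc 0 l, ∀ t ∈ Icc l (l + D), dist (γ s) (σ (t - l)) = t - s := by
    intro s hs t ht
    have htm : t - l ∈ Icc 0 D := ⟨by linarith [ht.1], by linarith [ht.2]⟩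
    have e1 := hγ.dist_zero hs
    have e2 := hγ s hs l ⟨hl0, le_rfl⟩
    have e3 := hσ.dist_zero htm
    have e4 := hσ (t - l) htm D ⟨hD, le_rfl⟩
    rw [abs_of_nonpos (by linarith [hs.2])] at e2
    rw [abs_of_nonpos (by linarith [htm.2])] at e4
    rw [hl] at e2
    have t1 := dist_triangle (γ s) (σ 0) (σ (t - l))
    have t2 := dist_triangle4 (γ 0) (γ s) (σ (t - l)) (σ D)
    linarith
  intro s hs t ht
  rcases le_total s l with h1 | h1 <;> rcases le_total t l with h2 | h2
  · rw [pathConcat_of_le h1, pathConcat_of_le h2, hγ s ⟨hs.1, h1⟩ t ⟨ht.1, h2⟩]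
  · rw [pathConcat_of_le h1, pathConcat_of_ge hl h2, cross s ⟨hs.1, h1⟩ t ⟨h2, ht.2⟩,
      abs_sub_comm, abs_of_nonneg (by linarith)]
  · rw [pathConcat_of_ge hl h1, pathConcat_of_le h2, dist_comm, cross t ⟨ht.1, h2⟩ s ⟨h1, hs.2⟩,
      abs_of_nonneg (by linarith)]
  · rw [pathConcat_of_ge hl h1, pathConcat_of_ge hl h2,
      hσ (s - l) ⟨by linarith, by linarith [hs.2]⟩ (t - l) ⟨by linarith, by linarith [ht.2]⟩]
    congr 1; ring

variable {PX : Set (Set X)}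

/-- A simple loop parametrized by an interval lies in one piece. -/
theorem IsTreeGraded.exists_piece_of_loop (h : IsTreeGraded X PX) {g : ℝ → X} {a b : ℝ}
    (hab : a < b) (hg : ContinuousOn g (Icc a b)) (hgab : g a = g b) (hinj : InjOn g (Ico a b)) :
    ∃ P ∈ PX, ∀ t ∈ Icc a b, g t ∈ P := by
  have hba : 0 < b - a := sub_pos.2 hab
  set k : ℝ → X := fun t => g (a + t * (b - a)) with hk
  have hkc : ContinuousOn k (Icc 0 (0 + 1)) := by
    refine hg.comp (by fun_prop) fun t ht => ⟨?_, ?_⟩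
    · nlinarith [ht.1]
    · nlinarith [ht.2]
  have hk01 : k 0 = k (0 + 1) := by simp [hk, hgab]
  obtain ⟨P, hP, hsub⟩ := h.t2 (AddCircle.liftIco 1 0 k) (AddCircle.liftIco_continuous hk01 hkc) (by
    intro x y hxy
    obtain ⟨s, hs, rfl⟩ : ∃ s ∈ Ico (0 : ℝ) (0 + 1), (s : AddCircle (1 : ℝ)) = x := by
      have := mem_univ x
      rwa [← AddCircle.coe_image_Ico_eq (1 : ℝ) 0] at this
    obtain ⟨t, ht, rfl⟩ : ∃ t ∈ Ico (0 : ℝ) (0 + 1), (t : AddCircle (1 : ℝ)) = y := by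
      have := mem_univ y
      rwa [← AddCircle.coe_image_Ico_eq (1 : ℝ) 0] at this
    rw [AddCircle.liftIco_coe_apply hs, AddCircle.liftIco_coe_apply ht] at hxy
    have := hinj ⟨by nlinarith [hs.1], by nlinarith [hs.2]⟩
      ⟨by nlinarith [ht.1], by nlinarith [ht.2]⟩ hxy
    have : s = t := mul_right_cancel₀ hba.ne' (add_left_cancel this)
    rw [this])
  have hIco : ∀ t ∈ Ico a b, g t ∈ P := by
    intro t ht
    have hs : (t - a) / (b - a) ∈ Ico (0 : ℝ) (0 + 1) :=
      ⟨div_nonneg (by linarith [ht.1]) hba.le, by rw [div_lt_iff₀ hba]; linarith [ht.2]⟩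
    have := hsub ⟨(((t - a) / (b - a) : ℝ) : AddCircle (1 : ℝ)), rfl⟩
    rw [AddCircle.liftIco_coe_apply hs] at this
    simpa [hk, div_mul_cancel₀ _ hba.ne'] using this
  refine ⟨P, hP, fun t ht => ?_⟩
  rcases ht.2.eq_or_lt with rfl | hlt
  · exact hgab ▸ hIco a ⟨le_rfl, hab⟩
  · exact hIco t ⟨ht.1, hlt⟩

/-- A simple arc with distinct endpoints in a piece lies in that piece. -/
theorem IsTreeGraded.arc_mem (h : IsTreeGraded X PX) {P : Set X} (hP : P ∈ PX) {c : ℝ → X}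
    {a b : ℝ} (hc : ContinuousOn c (Icc a b)) (hinj : InjOn c (Icc a b))
    (ha : c a ∈ P) (hb : c b ∈ P) {t : ℝ} (ht : t ∈ Icc a b) : c t ∈ P := by
  by_contra htP
  have hcl : IsClosed (Icc a b ∩ c ⁻¹' P) := hc.preimage_isClosed_of_isClosed isClosed_Icc (h.closed P hP)
  have hcpt : IsCompact (Icc a b ∩ c ⁻¹' P) := isCompact_Icc.of_isClosed_subset hcl inter_subset_left
  obtain ⟨u, ⟨⟨huI, huP⟩, hut⟩, humax⟩ := (hcpt.inter_right (isClosed_Iic (a := t))).exists_isGreatest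
    ⟨a, ⟨⟨le_rfl, ht.1.trans ht.2⟩, ha⟩, ht.1⟩
  obtain ⟨v, ⟨⟨hvI, hvP⟩, htv⟩, hvmin⟩ := (hcpt.inter_right (isClosed_Ici (a := t))).exists_isLeast
    ⟨b, ⟨⟨ht.1.trans ht.2, le_rfl⟩, hb⟩, ht.2⟩
  simp only [mem_Iic, mem_Ici, mem_preimage] at hut htv huP hvP
  have hut' : u < t := lt_of_le_of_ne hut fun e => htP (e ▸ huP)
  have htv' : t < v := lt_of_le_of_ne htv fun e => htP (e ▸ hvP)
  have hout : ∀ s ∈ Ioo u v, c s ∉ P := by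
    intro s hs hsP
    have hsI : s ∈ Icc a b := ⟨huI.1.trans hs.1.le, hs.2.le.trans hvI.2⟩
    rcases le_total s t with hst | hst
    · exact absurd (humax ⟨⟨hsI, hsP⟩, hst⟩) hs.1.not_ge
    · exact absurd (hvmin ⟨⟨hsI, hsP⟩, hst⟩) hs.2.not_ge
  have hne : c v ≠ c u := fun e => (hut'.trans htv').ne' (hinj hvI huI e)
  obtain ⟨σ, hσ, hσ0, hσ1, hσP⟩ := h.geodesicSub P hP _ hvP _ huP
  have hD : 0 < dist (c v) (c u) := dist_pos.2 hne
  set D := dist (c v) (c u)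
  have hsub : Icc u v ⊆ Icc a b := Icc_subset_Icc huI.1 hvI.2
  obtain ⟨Q, hQ, hgQ⟩ := h.exists_piece_of_loop (g := pathConcat c v σ) (a := u) (b := v + D)
    (by linarith) (pathConcat_continuousOn hσ0.symm (hc.mono hsub) hσ.continuousOn)
    (by rw [pathConcat_of_le (by linarith), pathConcat_of_ge hσ0.symm (by linarith),
          add_sub_cancel_left, hσ1]) (by
      have key : ∀ s t, s ∈ Icc u v → v < t → t < v + D → c s ≠ σ (t - v) := by
        intro s t hs h1 h2 e
        have htD : t - v ∈ Icc 0 D := ⟨by linarith, by linarith⟩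
        have hsP : c s ∈ P := e ▸ hσP _ htD
        rcases hs.1.eq_or_lt with rfl | hus
        · rw [← hσ1] at e
          have := hσ.injOn ⟨hD.le, le_rfl⟩ htD e
          linarith
        rcases hs.2.eq_or_lt with rfl | hsv
        · rw [← hσ0] at e
          have := hσ.injOn ⟨le_rfl, hD.le⟩ htD e
          linarith
        exact hout s ⟨hus, hsv⟩ hsP
      intro s hs s' hs' e
      rcases le_or_gt s v with h1 | h1 <;> rcases le_or_gt s' v with h2 | h2
      · rw [pathConcat_of_le h1, pathConcat_of_le h2] at e
        exact hinj (hsub ⟨hs.1, h1⟩) (hsub ⟨hs'.1, h2⟩) e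
      · rw [pathConcat_of_le h1, pathConcat_of_ge hσ0.symm h2.le] at e
        exact absurd e (key s s' ⟨hs.1, h1⟩ h2 hs'.2)
      · rw [pathConcat_of_ge hσ0.symm h1.le, pathConcat_of_le h2] at e
        exact absurd e.symm (key s' s ⟨hs'.1, h2⟩ h1 hs.2)
      · rw [pathConcat_of_ge hσ0.symm h1.le, pathConcat_of_ge hσ0.symm h2.le] at e
        have := hσ.injOn ⟨by linarith, by linarith [hs.2]⟩ ⟨by linarith, by linarith [hs'.2]⟩ e
        linarith)
  have hcQ : ∀ s ∈ Icc u v, c s ∈ Q := fun s hs => by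
    have := hgQ s ⟨hs.1, by linarith [hs.2]⟩
    rwa [pathConcat_of_le hs.2] at this
  have hQP : Q = P := by
    by_contra hQP
    exact hne (h.t1 Q hQ P hP hQP ⟨hcQ v ⟨by linarith, le_rfl⟩, hvP⟩ ⟨hcQ u ⟨le_rfl, by linarith⟩, huP⟩)
  exact htP (hQP ▸ hcQ t ⟨hut, htv⟩)

/-- Pieces are convex. -/
theorem IsTreeGraded.geodesic_mem (h : IsTreeGraded X PX) {P : Set X} (hP : P ∈ PX) {γ : ℝ → X}
    {a b : ℝ} (hγ : IsGeodesicSegment γ a b) (ha : γ a ∈ P) (hb : γ b ∈ P) {t : ℝ}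
    (ht : t ∈ Icc a b) : γ t ∈ P :=
  h.arc_mem hP hγ.continuousOn hγ.injOn ha hb ht

/-- Two geodesics issuing from a common point and ending in a piece `P` meet
at a common time in `P`. -/
theorem IsTreeGraded.exists_common_mem (h : IsTreeGraded X PX) {P : Set X} (hP : P ∈ PX)
    {α β : ℝ → X} {A B : ℝ} (hA : 0 ≤ A) (hB : 0 ≤ B) (hα : IsGeodesicSegment α 0 A)
    (hβ : IsGeodesicSegment β 0 B) (h0 : α 0 = β 0) (hαP : α A ∈ P) (hβP : β B ∈ P) :
    ∃ t ∈ Icc 0 A ∩ Icc 0 B, α t = β t ∧ α t ∈ P := by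
  have hcl : IsClosed {t ∈ Icc 0 (min A B) | α t = β t} := by
    have h1 : ContinuousOn (fun t => dist (α t) (β t)) (Icc 0 (min A B)) :=
      continuous_dist.comp_continuousOn
        ((hα.continuousOn.mono (Icc_subset_Icc_right (min_le_left _ _))).prodMk
          (hβ.continuousOn.mono (Icc_subset_Icc_right (min_le_right _ _))))
    have := h1.preimage_isClosed_of_isClosed isClosed_Icc (isClosed_singleton (x := (0 : ℝ)))
    convert this using 1
    ext t
    simp
  obtain ⟨w, ⟨hwI, hw⟩, hwmax⟩ := (isCompact_Icc.of_isClosed_subset hcl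
    (sep_subset _ _)).exists_isGreatest ⟨0, ⟨le_rfl, le_min hA hB⟩, h0⟩
  have hwA : w ≤ A := hwI.2.trans (min_le_left _ _)
  have hwB : w ≤ B := hwI.2.trans (min_le_right _ _)
  have hw0 : 0 ≤ w := hwI.1
  refine ⟨w, ⟨⟨hw0, hwA⟩, hw0, hwB⟩, hw, ?_⟩
  have hαr : ∀ s ∈ Icc (-(A - w)) 0, w - s ∈ Icc 0 A := fun s hs =>
    ⟨by linarith [hs.2], by linarith [hs.1]⟩
  have hβr : ∀ s ∈ Icc 0 (B - w), w + s ∈ Icc 0 B := fun s hs =>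
    ⟨by linarith [hs.1], by linarith [hs.2]⟩
  have hglue : (fun s => α (w - s)) 0 = (fun s => β (w + s)) 0 := by simpa using hw
  have key : ∀ s s', s ∈ Icc (-(A - w)) 0 → s' ∈ Icc 0 (B - w) → 0 < s' →
      α (w - s) ≠ β (w + s') := by
    intro s s' hs hs' hpos e
    have e1 := hα.dist_zero (hαr s hs)
    have e2 := hβ.dist_zero (hβr s' hs')
    rw [h0, e, e2] at e1
    have := hwmax ⟨⟨(hβr s' hs').1, le_min (e1 ▸ (hαr s hs).2) (hβr s' hs').2⟩, by rw [← e, e1]⟩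
    linarith
  have hmem := h.arc_mem hP (c := pathConcat (fun s => α (w - s)) 0 (fun s => β (w + s)))
    (a := -(A - w)) (b := 0 + (B - w)) (t := 0)
    (pathConcat_continuousOn hglue (hα.continuousOn.comp (by fun_prop) hαr)
      (hβ.continuousOn.comp (by fun_prop) hβr)) (by
      intro s hs s' hs' e
      rw [zero_add] at hs hs'
      rcases le_or_gt s 0 with h1 | h1 <;> rcases le_or_gt s' 0 with h2 | h2
      · rw [pathConcat_of_le h1, pathConcat_of_le h2] at e
        have := hα.injOn (hαr s ⟨hs.1, h1⟩) (hαr s' ⟨hs'.1, h2⟩) e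
        linarith
      · rw [pathConcat_of_le h1, pathConcat_of_ge hglue h2.le, sub_zero] at e
        exact absurd e (key s s' ⟨hs.1, h1⟩ ⟨h2.le, hs'.2⟩ h2)
      · rw [pathConcat_of_ge hglue h1.le, pathConcat_of_le h2, sub_zero] at e
        exact absurd e.symm (key s' s ⟨hs'.1, h2⟩ ⟨h1.le, hs.2⟩ h1)
      · rw [pathConcat_of_ge hglue h1.le, pathConcat_of_ge hglue h2.le, sub_zero, sub_zero] at e
        have := hβ.injOn (hβr s ⟨h1.le, hs.2⟩) (hβr s' ⟨h2.le, hs'.2⟩) e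
        linarith)
    (by rw [pathConcat_of_le (by linarith)]; simpa using hαP)
    (by rw [pathConcat_of_ge hglue (by linarith)]; simpa using hβP)
    ⟨by linarith, by linarith⟩
  rw [pathConcat_of_le le_rfl] at hmem
  simpa using hmem

/-- `p` is a nearest point of `S` to `z`. -/
def IsNearestPoint (S : Set X) (z p : X) : Prop :=
  p ∈ S ∧ dist z p = infDist z S

theorem IsNearestPoint.dist_le {S : Set X} {z p y : X} (hp : IsNearestPoint S z p) (hy : y ∈ S) :
    dist z p ≤ dist z y :=
  hp.2.trans_le (infDist_le_dist_of_mem hy)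

/-- A geodesic ending in a piece passes through the nearest point of that piece. -/
theorem IsTreeGraded.geodesic_through_nearest (hG : GeodesicSpace X) (h : IsTreeGraded X PX)
    {P : Set X} (hP : P ∈ PX) {p : X} {β : ℝ → X} {B : ℝ} (hp : IsNearestPoint P (β 0) p)
    (hB : 0 ≤ B) (hβ : IsGeodesicSegment β 0 B) (hβP : β B ∈ P) :
    dist (β 0) p ≤ B ∧ β (dist (β 0) p) = p := by
  obtain ⟨α, hα, hα0, hα1⟩ := hG (β 0) p
  obtain ⟨t, ht, hab, htP⟩ :=
    h.exists_common_mem hP dist_nonneg hB hα hβ hα0 (by rw [hα1]; exact hp.1) hβP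
  have h1 := hp.dist_le htP
  rw [hab, hβ.dist_zero ht.2] at h1
  have : dist (β 0) p = t := le_antisymm h1 ht.1.2
  exact ⟨this ▸ ht.2.2, by rw [this, ← hab, ← this, hα1]⟩

theorem IsTreeGraded.dist_eq_add (hG : GeodesicSpace X) (h : IsTreeGraded X PX)
    {P : Set X} (hP : P ∈ PX) {z p y : X} (hp : IsNearestPoint P z p) (hy : y ∈ P) :
    dist z y = dist z p + dist p y := by
  obtain ⟨β, hβ, rfl, hβ1⟩ := hG z y
  obtain ⟨h1, h2⟩ := h.geodesic_through_nearest hG hP hp dist_nonneg hβ (by rwa [hβ1])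
  have := hβ _ ⟨dist_nonneg, h1⟩ _ ⟨dist_nonneg, le_rfl⟩
  rw [h2, hβ1, abs_of_nonpos (by linarith)] at this
  linarith

/-- A piece projects to a single point of any other piece. -/
theorem IsTreeGraded.nearest_eq_of_mem (hG : GeodesicSpace X) (h : IsTreeGraded X PX)
    {proj : Set X → X → X} (hproj : ∀ P ∈ PX, ∀ x, IsNearestPoint P x (proj P x))
    {P Q : Set X} (hP : P ∈ PX) (hQ : Q ∈ PX) (hPQ : P ≠ Q) {u v : X} (hu : u ∈ P) (hv : v ∈ P) :
    proj Q u = proj Q v := by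
  have key : ∀ u ∈ P, ∀ v ∈ P, proj Q u ≠ proj Q v → proj Q u ∈ P := by
    intro u hu v hv hne
    set q := proj Q v with hqdef
    set q' := proj P q with hq'
    have hq := hproj Q hQ v
    have hp := hproj Q hQ u
    have hqP := hproj P hP q
    obtain ⟨σ, hσ, hσ0, hσ1, hσP⟩ := h.geodesicSub P hP u hu q' hqP.1
    obtain ⟨τ, hτ, hτ0, hτ1⟩ := hG q' q
    have e1 := h.dist_eq_add hG hP hqP hu
    have hβ := hσ.concat dist_nonneg dist_nonneg hτ (hσ1.trans hτ0.symm) (by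
      rw [hσ0, hτ1, dist_comm u q, e1, dist_comm u q', dist_comm q' q, add_comm])
    have hβ0 : pathConcat σ (dist u q') τ 0 = u := by rw [pathConcat_of_le dist_nonneg, hσ0]
    have hβ1 : pathConcat σ (dist u q') τ (dist u q' + dist q' q) = q := by
      rw [pathConcat_of_ge (hσ1.trans hτ0.symm) (by linarith [dist_nonneg (x := q') (y := q)]),
        add_sub_cancel_left, hτ1]
    obtain ⟨h1, h2⟩ := h.geodesic_through_nearest hG hQ (by rwa [hβ0])
      (add_nonneg dist_nonneg dist_nonneg) hβ (by rw [hβ1]; exact hq.1)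
    rw [hβ0] at h1 h2
    rcases le_total (dist u (proj Q u)) (dist u q') with h3 | h3
    · rw [pathConcat_of_le h3] at h2
      rw [← h2]
      exact hσP _ ⟨dist_nonneg, h3⟩
    · exfalso
      rw [pathConcat_of_ge (hσ1.trans hτ0.symm) h3] at h2
      set t := dist u (proj Q u) - dist u q'
      have ht : t ∈ Icc 0 (dist q' q) := ⟨sub_nonneg.2 h3, by simp only [t]; linarith⟩
      have d1 := hτ.dist_zero ht
      rw [h2, hτ0] at d1
      have d2 := h.dist_eq_add hG hP hqP hv
      have d3 := hq.dist_le hp.1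
      have d4 := dist_triangle v q' (proj Q u)
      rw [← hqdef, ← hq'] at *
      rw [dist_comm q v, dist_comm q q', dist_comm q' v] at d2
      have : t = dist q' q := by linarith [ht.2]
      rw [this, hτ1] at h2
      exact hne h2.symm
  by_contra hne
  exact hne (h.t1 P hP Q hQ hPQ ⟨key u hu v hv hne, (hproj Q hQ u).1⟩
    ⟨key v hv u hu (Ne.symm hne), (hproj Q hQ v).1⟩)

end TreeGradedGeometry

section IntervalDecomposition

/-- `S` is the disjoint union of the closed intervals `[a i, b i]`. -/
structure IsIntervalDecomp {ι : Type*} (S : Set ℝ) (a b : ι → ℝ) : Prop where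
  le : ∀ i, a i ≤ b i
  eq_iUnion : S = ⋃ i, Icc (a i) (b i)
  disj : ∀ i j, i ≠ j → b i < a j ∨ b j < a i

variable {ι κ : Type*} {S : Set ℝ} {a b : ι → ℝ} {a' b' : κ → ℝ}

theorem IsIntervalDecomp.eq_of_mem (h : IsIntervalDecomp S a b) {i j : ι} {t : ℝ}
    (hi : t ∈ Icc (a i) (b i)) (hj : t ∈ Icc (a j) (b j)) : i = j := by
  by_contra hij
  rcases h.disj i j hij with h | h
  · linarith [hi.2, hj.1]
  · linarith [hi.1, hj.2]

theorem IsIntervalDecomp.exists_mem (h : IsIntervalDecomp S a b) {t : ℝ} (ht : t ∈ S) :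
    ∃ i, t ∈ Icc (a i) (b i) :=
  mem_iUnion.1 (h.eq_iUnion ▸ ht)

theorem IsIntervalDecomp.subset (h : IsIntervalDecomp S a b) (i : ι) : Icc (a i) (b i) ⊆ S :=
  h.eq_iUnion ▸ subset_iUnion (fun i => Icc (a i) (b i)) i

theorem IsIntervalDecomp.exists_Icc_subset [Finite ι] (h : IsIntervalDecomp S a b) {c d : ℝ}
    (hcd : c ≤ d) (hS : Icc c d ⊆ S) : ∃ i, Icc c d ⊆ Icc (a i) (b i) := by
  obtain ⟨i, hi⟩ := h.exists_mem (hS ⟨le_rfl, hcd⟩)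
  refine ⟨i, Icc_subset_Icc hi.1 ?_⟩
  by_contra! hlt
  have hcl : IsClosed (⋃ j : {j // j ≠ i}, Icc (a j) (b j)) :=
    isClosed_iUnion_of_finite fun _ => isClosed_Icc
  have hsub : Ioc (b i) d ⊆ ⋃ j : {j // j ≠ i}, Icc (a j) (b j) := by
    intro t ht
    obtain ⟨j, hj⟩ := h.exists_mem (hS ⟨hi.2.trans ht.1.le, ht.2⟩)
    refine mem_iUnion.2 ⟨⟨j, ?_⟩, hj⟩
    rintro rfl
    exact absurd hj.2 ht.1.not_ge
  have hmem := closure_minimal hsub hcl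
    (by rw [closure_Ioc hlt.ne]; exact ⟨le_rfl, hlt.le⟩ : b i ∈ closure (Ioc (b i) d))
  obtain ⟨⟨j, hji⟩, hj⟩ := mem_iUnion.1 hmem
  exact hji (h.eq_of_mem hj ⟨h.le i, le_rfl⟩)

theorem IsIntervalDecomp.exists_eq [Finite ι] [Finite κ] (h : IsIntervalDecomp S a b)
    (h' : IsIntervalDecomp S a' b') (i : ι) : ∃ j, a' j = a i ∧ b' j = b i := by
  obtain ⟨j, hj⟩ := h'.exists_Icc_subset (h.le i) (h.subset i)
  obtain ⟨i', hi'⟩ := h.exists_Icc_subset (h'.le j) (h'.subset j)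
  obtain rfl : i = i' := h.eq_of_mem ⟨le_rfl, h.le i⟩ (hi' (hj ⟨le_rfl, h.le i⟩))
  have h1 := (Icc_subset_Icc_iff (h.le i)).1 hj
  have h2 := (Icc_subset_Icc_iff (h'.le j)).1 hi'
  exact ⟨j, le_antisymm h1.1 h2.1, le_antisymm h2.2 h1.2⟩

/-- A sum over the intervals of a decomposition depends only on the decomposed set. -/
theorem IsIntervalDecomp.sum_eq [Fintype ι] [Fintype κ] (h : IsIntervalDecomp S a b)
    (h' : IsIntervalDecomp S a' b') (F : ℝ → ℝ → ℕ) :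
    ∑ i, F (a i) (b i) = ∑ j, F (a' j) (b' j) := by
  choose e he using h.exists_eq h'
  refine Fintype.sum_bijective e ⟨fun i j hij => ?_, fun j => ?_⟩ _ _ fun i => ?_
  · refine h.eq_of_mem (t := a i) ⟨le_rfl, h.le i⟩ ?_
    rw [← (he i).1, hij, (he j).1]
    exact ⟨le_rfl, h.le j⟩
  · obtain ⟨i, hi⟩ := h'.exists_eq h j
    refine ⟨i, h'.eq_of_mem (t := a' j) ?_ ⟨le_rfl, h'.le j⟩⟩
    rw [(he i).1, (he i).2, hi.1, hi.2]
    exact ⟨le_rfl, h'.le j⟩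
  · rw [(he i).1, (he i).2]

/-- Extending the last interval of a decomposition. -/
theorem IsIntervalDecomp.update_last [DecidableEq ι] (h : IsIntervalDecomp S a b) {l m : ℝ}
    (hS : S ⊆ Iic l) {i₀ : ι} (hi₀ : b i₀ = l) (hlm : l ≤ m) :
    IsIntervalDecomp (S ∪ Icc l m) a (Function.update b i₀ m) := by
  have hle : ∀ i, b i ≤ l := fun i => hS (h.subset i ⟨h.le i, le_rfl⟩)
  have hlast : ∀ i, i ≠ i₀ → b i < a i₀ := by
    intro i hi
    rcases h.disj i i₀ hi with h1 | h1
    · exact h1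
    · linarith [h.le i, hle i]
  refine ⟨fun i => ?_, ?_, fun i j hij => ?_⟩
  · rcases eq_or_ne i i₀ with rfl | hi
    · simp only [Function.update_self]; linarith [h.le i]
    · simpa [hi] using h.le i
  · ext t
    constructor
    · rintro (ht | ht)
      · obtain ⟨i, hi⟩ := h.exists_mem ht
        refine mem_iUnion.2 ⟨i, hi.1, hi.2.trans ?_⟩
        rcases eq_or_ne i i₀ with rfl | hi
        · simp only [Function.update_self]; linarith
        · simp [hi]
      · refine mem_iUnion.2 ⟨i₀, ?_, ?_⟩
        · linarith [h.le i₀, ht.1]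
        · simpa using ht.2
    · intro ht
      obtain ⟨i, hi⟩ := mem_iUnion.1 ht
      rcases eq_or_ne i i₀ with rfl | hne
      · rcases le_total t l with htl | htl
        · exact Or.inl (h.subset i ⟨hi.1, hi₀ ▸ htl⟩)
        · exact Or.inr ⟨htl, by simpa using hi.2⟩
      · exact Or.inl (h.subset i (by simpa [hne] using hi))
  · rcases eq_or_ne i i₀ with rfl | hi
    · exact Or.inr (by simpa [hij.symm] using hlast j hij.symm)
    · rcases eq_or_ne j i₀ with rfl | hj
      · exact Or.inl (by simpa [hi] using hlast i hi)
      · simpa [hi, hj] using h.disj i j hij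

/-- Adding a point beyond a decomposition. -/
theorem IsIntervalDecomp.insert_point (h : IsIntervalDecomp S a b) {L : ℝ} (hS : S ⊆ Iio L) :
    IsIntervalDecomp (S ∪ {L}) (fun o : Option ι => o.elim L a) (fun o => o.elim L b) := by
  have hlt : ∀ i, b i < L := fun i => hS (h.subset i ⟨h.le i, le_rfl⟩)
  refine ⟨?_, ?_, ?_⟩
  · rintro (_ | i)
    · exact le_rfl
    · exact h.le i
  · rw [iUnion_option, h.eq_iUnion, union_comm]
    simp
  · rintro (_ | i) (_ | j) hij
    · exact absurd rfl hij
    · exact Or.inr (hlt j)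
    · exact Or.inl (hlt i)
    · exact h.disj i j fun e => hij (e ▸ rfl)

end IntervalDecomposition

section PathTimes

variable {X : Type*} {PX : Set (Set X)} {Q : Set X} {γ γ' : ℝ → X} {L : ℝ}

theorem setOf_mem_congr (h : ∀ t ∈ Icc 0 L, γ t = γ' t) (Q : Set X) :
    {t | t ∈ Icc 0 L ∧ γ t ∈ Q} = {t | t ∈ Icc 0 L ∧ γ' t ∈ Q} := by
  ext t
  exact and_congr_right fun ht => by rw [h t ht]

theorem floorLen_congr {a b : ℝ} (h : ∀ t ∈ Icc a b, γ t = γ' t) :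
    floorLen PX γ a b = floorLen PX γ' a b := by
  unfold floorLen
  congr 2
  ext t
  refine and_congr_right fun ht => ?_
  rw [image_congr fun s hs => h s ⟨ht.1.trans hs.1, hs.2⟩]

theorem pieceEnd_le (h : ∃ t ∈ Icc 0 L, γ t ∈ Q) : pieceEnd γ L Q ≤ L :=
  csSup_le h fun _ ht => ht.1.2

theorem pieceStart_le {t : ℝ} (ht : t ∈ Icc 0 L) (h : γ t ∈ Q) : pieceStart γ L Q ≤ t :=
  csInf_le ⟨0, fun _ hs => hs.1.1⟩ ⟨ht, h⟩

theorem le_pieceEnd {t : ℝ} (ht : t ∈ Icc 0 L) (h : γ t ∈ Q) : t ≤ pieceEnd γ L Q :=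
  le_csSup ⟨L, fun _ hs => hs.1.2⟩ ⟨ht, h⟩

theorem IsDChain.mono {Y : Type*} {d : Y → Y → ℝ} {r : ℝ} {S T : Set Y} {x y : Y} (h : IsDChain d r S x y)
    (hST : S ⊆ T) : IsDChain d r T x y := by
  obtain ⟨m, c, h0, hm, hS, hd⟩ := h
  exact ⟨m, c, h0, hm, fun i hi => hST (hS i hi), hd⟩

end PathTimes

section ColoringAlongPiece

variable {X : Type*} [MetricSpace X] {PX : Set (Set X)} {n : ℕ} {r fr : ℝ} {xhat : X}
  {proj : Set X → X → X} {cP : Set X → X → Fin (n + 1)} {P Q : Set X} {γ γ' : ℝ → X} {l L : ℝ}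

theorem ColoringSetup.isNearestPoint (hs : ColoringSetup X PX n r fr xhat proj cP) :
    ∀ P ∈ PX, ∀ x, IsNearestPoint P x (proj P x) :=
  fun P hP x => ⟨hs.projMem P hP x, hs.projDist P hP x⟩

theorem ColoringSetup.proj_of_mem (hs : ColoringSetup X PX n r fr xhat proj cP) (hP : P ∈ PX)
    {x : X} (hx : x ∈ P) : proj P x = x := by
  have := (hs.isNearestPoint P hP x).dist_le hx
  rw [dist_self] at this
  exact (dist_le_zero.1 this).symm

theorem ColoringSetup.color_base (hs : ColoringSetup X PX n r fr xhat proj cP) (hP : P ∈ PX) :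
    cP P (proj P xhat) = 0 :=
  hs.ballZero P hP _ (hs.projMem P hP xhat) (by rw [dist_self]; linarith [hs.rpos])

theorem ColoringSetup.mem_pieceComp_of_dist_lt (hs : ColoringSetup X PX n r fr xhat proj cP)
    (hP : P ∈ PX) {y : X} (hy : y ∈ P) (hd : dist (proj P xhat) y < r) :
    y ∈ pieceComp r xhat proj cP P := by
  refine ⟨1, fun i => if i = 0 then proj P xhat else y, by simp, by simp, fun i _ => ?_,
    fun i hi => ?_⟩
  · by_cases h : i = 0
    · simpa [h] using ⟨hs.projMem P hP xhat, hs.color_base hP⟩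
    · simpa [h] using ⟨hy, hs.ballZero P hP y hy (by rw [dist_comm]; linarith [hs.rpos])⟩
  · obtain rfl : i = 0 := by omega
    simpa using hd

theorem ColoringSetup.base_mem_pieceComp (hs : ColoringSetup X PX n r fr xhat proj cP)
    (hP : P ∈ PX) : proj P xhat ∈ pieceComp r xhat proj cP P :=
  hs.mem_pieceComp_of_dist_lt hP (hs.projMem P hP xhat) (by rw [dist_self]; exact hs.rpos)

theorem mem_betaSet {t : ℝ} : t ∈ betaSet PX r xhat proj cP γ L ↔
    t ∈ Icc 0 L ∧ ∀ Q, IsLongPiece PX r xhat proj cP γ L Q →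
      t ∉ Ioo (pieceStart γ L Q + r / 2) (pieceEnd γ L Q) := by
  simp only [betaSet, mem_sdiff, mem_iUnion, mem_ofPred_eq, not_exists]

theorem betaSet_congr (hL : 0 ≤ L) (h : ∀ t ∈ Icc 0 L, γ t = γ' t) :
    betaSet PX r xhat proj cP γ L = betaSet PX r xhat proj cP γ' L := by
  ext t
  have hlong : ∀ Q, IsLongPiece PX r xhat proj cP γ L Q ↔ IsLongPiece PX r xhat proj cP γ' L Q := by
    intro Q
    have : (∃ t ∈ Icc 0 L, γ t ∈ Q) ↔ ∃ t ∈ Icc 0 L, γ' t ∈ Q :=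
      exists_congr fun t => and_congr_right fun ht => by rw [h t ht]
    rw [IsLongPiece, IsLongPiece, this, h L ⟨hL, le_rfl⟩]
  simp only [mem_betaSet, hlong, pieceStart, pieceEnd, setOf_mem_congr h]

theorem floorLen_self (hG : IsTreeGraded X PX) (a : ℝ) : floorLen PX γ a a = 0 := by
  obtain ⟨Q, hQ, hQm⟩ := hG.covers (γ a)
  have : {t | t ∈ Icc a a ∧ ∃ P ∈ PX, γ '' Icc t a ⊆ P} = {a} := by
    ext t
    simp only [Icc_self, mem_singleton_iff, mem_ofPred_eq, and_iff_left_iff_imp]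
    rintro rfl
    exact ⟨Q, hQ, by simpa using hQm⟩
  rw [floorLen, this, csInf_singleton, sub_self]

/-- The geodesic `γ : [0, L] → X` issues from `x̂`, enters the piece `P` at time `l < L`
and stays in `P` until its end. -/
structure EntersPiece (xhat : X) (P : Set X) (γ : ℝ → X) (l L : ℝ) : Prop where
  geod : IsGeodesicSegment γ 0 L
  start : γ 0 = xhat
  nonneg : 0 ≤ l
  lt : l < L
  mem_iff : ∀ t ∈ Icc 0 L, γ t ∈ P ↔ l ≤ t

theorem EntersPiece.entry_mem (h : EntersPiece xhat P γ l L) : γ l ∈ P :=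
  (h.mem_iff l ⟨h.nonneg, h.lt.le⟩).2 le_rfl

theorem EntersPiece.end_mem (h : EntersPiece xhat P γ l L) : γ L ∈ P :=
  (h.mem_iff L ⟨h.nonneg.trans h.lt.le, le_rfl⟩).2 h.lt.le

theorem EntersPiece.pieceStart_eq (h : EntersPiece xhat P γ l L) : pieceStart γ L P = l :=
  IsLeast.csInf_eq ⟨⟨⟨h.nonneg, h.lt.le⟩, h.entry_mem⟩, fun t ht => (h.mem_iff t ht.1).1 ht.2⟩

theorem EntersPiece.pieceEnd_eq (h : EntersPiece xhat P γ l L) : pieceEnd γ L P = L :=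
  IsGreatest.csSup_eq ⟨⟨⟨h.nonneg.trans h.lt.le, le_rfl⟩, h.end_mem⟩, fun _ ht => ht.1.2⟩

/-- Another piece meets the part of the geodesic in `P` at most once. -/
theorem EntersPiece.time_unique (h : EntersPiece xhat P γ l L) (hG : IsTreeGraded X PX)
    (hP : P ∈ PX) (hQ : Q ∈ PX) (hQP : Q ≠ P) {s t : ℝ} (hs : s ∈ Icc l L) (ht : t ∈ Icc l L)
    (hsQ : γ s ∈ Q) (htQ : γ t ∈ Q) : s = t := by
  have hs' : s ∈ Icc 0 L := ⟨h.nonneg.trans hs.1, hs.2⟩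
  have ht' : t ∈ Icc 0 L := ⟨h.nonneg.trans ht.1, ht.2⟩
  exact h.geod.injOn hs' ht' (hG.t1 Q hQ P hP hQP ⟨hsQ, (h.mem_iff s hs').2 hs.1⟩
    ⟨htQ, (h.mem_iff t ht').2 ht.1⟩)

theorem EntersPiece.setOf_mem_eq (h : EntersPiece xhat P γ l L) (hG : IsTreeGraded X PX)
    (hP : P ∈ PX) (hQ : Q ∈ PX) (hQP : Q ≠ P) (hmeet : ∃ t ∈ Icc 0 l, γ t ∈ Q) :
    {t | t ∈ Icc 0 L ∧ γ t ∈ Q} = {t | t ∈ Icc 0 l ∧ γ t ∈ Q} := by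
  obtain ⟨s, hs, hsQ⟩ := hmeet
  ext t
  refine ⟨fun ⟨ht, htQ⟩ => ⟨⟨ht.1, ?_⟩, htQ⟩, fun ⟨ht, htQ⟩ => ⟨⟨ht.1, ht.2.trans h.lt.le⟩, htQ⟩⟩
  by_contra! hlt
  have hlQ : γ l ∈ Q := hG.geodesic_mem hQ (h.geod.mono hs.1 ht.2) hsQ htQ ⟨hs.2, hlt.le⟩
  exact hlt.ne (h.time_unique hG hP hQ hQP ⟨le_rfl, h.lt.le⟩ ⟨hlt.le, ht.2⟩ hlQ htQ)

theorem EntersPiece.proj_end (h : EntersPiece xhat P γ l L)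
    (hs : ColoringSetup X PX n r fr xhat proj cP) (hP : P ∈ PX) (hQ : Q ∈ PX) (hQP : Q ≠ P) :
    proj Q (γ L) = proj Q (γ l) :=
  hs.treeGraded.nearest_eq_of_mem hs.geodesic hs.isNearestPoint hP hQ hQP.symm h.end_mem h.entry_mem

theorem EntersPiece.entry_eq (h : EntersPiece xhat P γ l L)
    (hs : ColoringSetup X PX n r fr xhat proj cP) (hP : P ∈ PX) : γ l = proj P xhat := by
  have h0 : IsNearestPoint P (γ 0) (proj P xhat) := h.start ▸ hs.isNearestPoint P hP _
  obtain ⟨h1, h2⟩ := hs.treeGraded.geodesic_through_nearest hs.geodesic hP h0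
    (h.nonneg.trans h.lt.le) h.geod h.end_mem
  have h3 : l ≤ dist (γ 0) (proj P xhat) :=
    (h.mem_iff _ ⟨dist_nonneg, h1⟩).1 (by rw [h2]; exact hs.projMem P hP xhat)
  have h4 := h0.dist_le h.entry_mem
  rw [h.geod.dist_zero ⟨h.nonneg, h.lt.le⟩] at h4
  rw [← h2, le_antisymm h4 h3]

theorem EntersPiece.isLongPiece_iff (h : EntersPiece xhat P γ l L)
    (hs : ColoringSetup X PX n r fr xhat proj cP) (hP : P ∈ PX) (hQP : Q ≠ P) :
    IsLongPiece PX r xhat proj cP γ L Q ↔ IsLongPiece PX r xhat proj cP γ l Q := by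
  have hG := hs.treeGraded
  refine ⟨fun ⟨hQ, ⟨t, ht, htQ⟩, hlong⟩ => ?_, fun ⟨hQ, ⟨t, ht, htQ⟩, hlong⟩ =>
    ⟨hQ, ⟨t, ⟨ht.1, ht.2.trans h.lt.le⟩, htQ⟩, by rwa [h.proj_end hs hP hQ hQP]⟩⟩
  refine ⟨hQ, ?_, by rwa [← h.proj_end hs hP hQ hQP]⟩
  by_contra! hno
  have after : ∀ s ∈ Icc 0 L, γ s ∈ Q → s ∈ Icc l L := fun s hsI hsQ =>
    ⟨le_of_not_gt fun hlt => hno s ⟨hsI.1, hlt.le⟩ hsQ, hsI.2⟩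
  have htl := after t ht htQ
  obtain ⟨h1, h2⟩ := hG.geodesic_through_nearest hs.geodesic hQ
    (p := proj Q xhat) (h.start ▸ hs.isNearestPoint Q hQ _) ht.1 (h.geod.mono le_rfl ht.2) htQ
  have hpI : dist (γ 0) (proj Q xhat) ∈ Icc 0 L := ⟨dist_nonneg, h1.trans ht.2⟩
  have hpQ : γ (dist (γ 0) (proj Q xhat)) ∈ Q := by
    rw [h2]; exact hs.projMem Q hQ xhat
  rw [h.time_unique hG hP hQ hQP (after _ hpI hpQ) htl hpQ htQ] at h2
  refine hlong ?_
  rw [hG.nearest_eq_of_mem hs.geodesic hs.isNearestPoint hP hQ hQP.symm h.end_mem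
    ((h.mem_iff t ht).2 htl.1), hs.proj_of_mem hQ htQ, h2]
  exact hs.base_mem_pieceComp hQ

theorem EntersPiece.mem_betaSet_iff (h : EntersPiece xhat P γ l L)
    (hs : ColoringSetup X PX n r fr xhat proj cP) (hP : P ∈ PX) {t : ℝ} :
    t ∈ betaSet PX r xhat proj cP γ L ↔ (t ∈ betaSet PX r xhat proj cP γ l ∨ t ∈ Icc l L) ∧
      (γ L ∉ pieceComp r xhat proj cP P → t ∉ Ioo (l + r / 2) L) := by
  have hG := hs.treeGraded
  have hlongP : IsLongPiece PX r xhat proj cP γ L P ↔ γ L ∉ pieceComp r xhat proj cP P := by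
    rw [IsLongPiece, hs.proj_of_mem hP h.end_mem]
    exact ⟨fun h => h.2.2, fun h' => ⟨hP, ⟨L, ⟨h.nonneg.trans h.lt.le, le_rfl⟩, h.end_mem⟩, h'⟩⟩
  have hshort : ¬ IsLongPiece PX r xhat proj cP γ l P := fun h' => h'.2.2 (by
    rw [hs.proj_of_mem hP h.entry_mem, h.entry_eq hs hP]
    exact hs.base_mem_pieceComp hP)
  have hother : (∀ Q, IsLongPiece PX r xhat proj cP γ L Q →
      t ∉ Ioo (pieceStart γ L Q + r / 2) (pieceEnd γ L Q)) ↔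
      (∀ Q, IsLongPiece PX r xhat proj cP γ l Q →
        t ∉ Ioo (pieceStart γ l Q + r / 2) (pieceEnd γ l Q)) ∧
      (γ L ∉ pieceComp r xhat proj cP P → t ∉ Ioo (l + r / 2) L) := by
    have hsame : ∀ Q, IsLongPiece PX r xhat proj cP γ l Q →
        pieceStart γ L Q = pieceStart γ l Q ∧ pieceEnd γ L Q = pieceEnd γ l Q := by
      intro Q hQ
      have := h.setOf_mem_eq hG hP hQ.1 (fun e => hshort (e ▸ hQ)) hQ.2.1
      rw [pieceStart, pieceStart, pieceEnd, pieceEnd, this]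
      exact ⟨rfl, rfl⟩
    constructor
    · refine fun H => ⟨fun Q hQ => ?_, fun hy => ?_⟩
      · rw [← (hsame Q hQ).1, ← (hsame Q hQ).2]
        exact H Q ((h.isLongPiece_iff hs hP fun e => hshort (e ▸ hQ)).2 hQ)
      · have := H P (hlongP.2 hy)
        rwa [h.pieceStart_eq, h.pieceEnd_eq] at this
    · rintro ⟨H1, H2⟩ Q hQ
      by_cases hQP : Q = P
      · subst hQP
        rw [h.pieceStart_eq, h.pieceEnd_eq]
        exact H2 (hlongP.1 hQ)
      · have hQ' := (h.isLongPiece_iff hs hP hQP).1 hQ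
        rw [(hsame Q hQ').1, (hsame Q hQ').2]
        exact H1 Q hQ'
  rw [mem_betaSet, hother, mem_betaSet, ← and_assoc]
  refine and_congr_left fun _ => ⟨fun ⟨ht, H⟩ => ?_, ?_⟩
  · rcases le_total t l with htl | htl
    · exact Or.inl ⟨⟨ht.1, htl⟩, H⟩
    · exact Or.inr ⟨htl, ht.2⟩
  · rintro (⟨ht, H⟩ | ht)
    · exact ⟨⟨ht.1, ht.2.trans h.lt.le⟩, H⟩
    · exact ⟨⟨h.nonneg.trans ht.1, ht.2⟩, fun Q hQ hmem =>
        absurd ht.1 (hmem.2.trans_le (pieceEnd_le hQ.2.1)).not_ge⟩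

theorem EntersPiece.betaSet_of_short (h : EntersPiece xhat P γ l L)
    (hs : ColoringSetup X PX n r fr xhat proj cP) (hP : P ∈ PX)
    (hy : γ L ∈ pieceComp r xhat proj cP P) :
    betaSet PX r xhat proj cP γ L = betaSet PX r xhat proj cP γ l ∪ Icc l L := by
  ext t
  simp [h.mem_betaSet_iff hs hP, hy]

theorem EntersPiece.half_lt_of_long (h : EntersPiece xhat P γ l L)
    (hs : ColoringSetup X PX n r fr xhat proj cP) (hP : P ∈ PX)
    (hy : γ L ∉ pieceComp r xhat proj cP P) : l + r / 2 < L := by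
  by_contra! hle
  refine hy (hs.mem_pieceComp_of_dist_lt hP h.end_mem ?_)
  have h0 := h.nonneg
  have h1 := h.lt
  rw [← h.entry_eq hs hP, h.geod l ⟨h0, h1.le⟩ L ⟨h0.trans h1.le, le_rfl⟩, abs_sub_comm,
    abs_of_pos (by linarith)]
  linarith [hs.rpos]

theorem EntersPiece.betaSet_of_long (h : EntersPiece xhat P γ l L)
    (hs : ColoringSetup X PX n r fr xhat proj cP) (hP : P ∈ PX)
    (hy : γ L ∉ pieceComp r xhat proj cP P) :
    betaSet PX r xhat proj cP γ L =
      betaSet PX r xhat proj cP γ l ∪ Icc l (l + r / 2) ∪ {L} := by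
  have hlt := h.half_lt_of_long hs hP hy
  have hr := hs.rpos
  ext t
  rw [h.mem_betaSet_iff hs hP, union_assoc, mem_union, mem_union, mem_singleton_iff]
  constructor
  · rintro ⟨ht | ht, hn⟩
    · exact Or.inl ht
    · rcases le_or_gt t (l + r / 2) with h1 | h1
      · exact Or.inr (Or.inl ⟨ht.1, h1⟩)
      · exact Or.inr (Or.inr (le_antisymm ht.2 (not_lt.1 fun h2 => hn hy ⟨h1, h2⟩)))
  · rintro (ht | ht | rfl)
    · exact ⟨Or.inl ht, fun _ h' => by linarith [(mem_betaSet.1 ht).1.2, h'.1]⟩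
    · exact ⟨Or.inr ⟨ht.1, ht.2.trans hlt.le⟩, fun _ h' => ht.2.not_gt h'.1⟩
    · exact ⟨Or.inr ⟨h.lt.le, le_rfl⟩, fun _ h' => h'.2.false⟩

theorem EntersPiece.floorLen_eq (h : EntersPiece xhat P γ l L) (hG : IsTreeGraded X PX)
    (hP : P ∈ PX) {a m : ℝ} (ha0 : 0 ≤ a) (hal : a ≤ l) (hlm : l < m) (hmL : m ≤ L) :
    floorLen PX γ a m = l - a := by
  have : IsLeast {t | t ∈ Icc a m ∧ ∃ Q ∈ PX, γ '' Icc t m ⊆ Q} l := by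
    refine ⟨⟨⟨hal, hlm.le⟩, P, hP, ?_⟩, ?_⟩
    · rintro _ ⟨s, hs, rfl⟩
      exact (h.mem_iff s ⟨h.nonneg.trans hs.1, hs.2.trans hmL⟩).2 hs.1
    · rintro t ⟨ht, Q, hQ, hsub⟩
      by_contra! hlt
      have hmem : ∀ s ∈ Icc t m, γ s ∈ Q := fun s hs => hsub ⟨s, hs, rfl⟩
      by_cases hQP : Q = P
      · subst hQP
        exact hlt.not_ge ((h.mem_iff t ⟨ha0.trans ht.1, ht.2.trans hmL⟩).1
          (hmem t ⟨le_rfl, ht.2⟩))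
      · exact hlm.ne (h.time_unique hG hP hQ hQP ⟨le_rfl, h.lt.le⟩ ⟨hlm.le, hmL⟩
          (hmem l ⟨hlt.le, hlm.le⟩) (hmem m ⟨ht.2, le_rfl⟩))
  rw [floorLen, this.csInf_eq]

/-- The last piece on the last component of `betaSet` has length at most `8 f(r)`. -/
theorem ColoringSetup.floorLen_bounds (hs : ColoringSetup X PX n r fr xhat proj cP)
    (hγ : IsGeodesicSegment γ 0 l) (h0 : γ 0 = xhat) {a : ℝ} (ha0 : 0 ≤ a) (hal : a ≤ l)
    (hsub : Icc a l ⊆ betaSet PX r xhat proj cP γ l) :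
    0 ≤ floorLen PX γ a l ∧ floorLen PX γ a l ≤ l - a ∧ l - a ≤ floorLen PX γ a l + 8 * fr := by
  have hl0 : 0 ≤ l := ha0.trans hal
  have hr := hs.rpos
  have hrf := hs.rlefr
  obtain ⟨R, hR, hRm⟩ := hs.treeGraded.covers (γ l)
  have hl : l ∈ {t | t ∈ Icc a l ∧ ∃ Q ∈ PX, γ '' Icc t l ⊆ Q} :=
    ⟨⟨hal, le_rfl⟩, R, hR, by simpa using hRm⟩
  have hbdd : BddBelow {t | t ∈ Icc a l ∧ ∃ Q ∈ PX, γ '' Icc t l ⊆ Q} := ⟨a, fun t ht => ht.1.1⟩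
  have h1 := le_csInf ⟨l, hl⟩ fun t (ht : t ∈ {t | t ∈ Icc a l ∧ ∃ Q ∈ PX, γ '' Icc t l ⊆ Q}) =>
    ht.1.1
  have h2 := csInf_le hbdd hl
  have h3 : l - 8 * fr ≤ sInf {t | t ∈ Icc a l ∧ ∃ Q ∈ PX, γ '' Icc t l ⊆ Q} := by
    refine le_csInf ⟨l, hl⟩ ?_
    rintro t ⟨ht, Q, hQ, hQsub⟩
    have htI : t ∈ Icc 0 l := ⟨ha0.trans ht.1, ht.2⟩
    have hlI : l ∈ Icc 0 l := ⟨hl0, le_rfl⟩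
    have htQ : γ t ∈ Q := hQsub ⟨t, ⟨le_rfl, ht.2⟩, rfl⟩
    have hlQ : γ l ∈ Q := hQsub ⟨l, ⟨ht.2, le_rfl⟩, rfl⟩
    by_cases hlong : IsLongPiece PX r xhat proj cP γ l Q
    · have hst := pieceStart_le htI htQ
      have hen := le_pieceEnd hlI hlQ
      by_contra! hlt
      have hmid : (t + r / 2 + l) / 2 ∈ Icc a l := ⟨by linarith [ht.1], by linarith⟩
      exact (mem_betaSet.1 (hsub hmid)).2 Q hlong ⟨by linarith, by linarith⟩
    · have hcomp : γ l ∈ pieceComp r xhat proj cP Q := by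
        by_contra hc
        exact hlong ⟨hQ, ⟨t, htI, htQ⟩, by rwa [hs.proj_of_mem hQ hlQ]⟩
      have d1 := hs.zeroBounded Q hQ _ _ hcomp
      have d2 := (hs.isNearestPoint Q hQ xhat).dist_le htQ
      have d3 := dist_triangle xhat (proj Q xhat) (γ l)
      rw [← h0] at d1 d2 d3
      rw [hγ.dist_zero htI] at d2
      rw [hγ.dist_zero hlI] at d3
      linarith
  unfold floorLen
  exact ⟨by linarith, by linarith, by linarith⟩

/-- Any point of `P` other than `x_P` is reached by a geodesic prolonging a given geodesic
from `x̂` to `x_P` and entering `P` at `x_P`. -/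
theorem ColoringSetup.exists_entersPiece (hs : ColoringSetup X PX n r fr xhat proj cP)
    (hP : P ∈ PX) {γ₀ : ℝ → X} (hγ : IsGeodesicSegment γ₀ 0 (dist xhat (proj P xhat)))
    (h0 : γ₀ 0 = xhat) (h1 : γ₀ (dist xhat (proj P xhat)) = proj P xhat) {y : X} (hy : y ∈ P)
    (hne : y ≠ proj P xhat) :
    ∃ (γ : ℝ → X) (L : ℝ), EntersPiece xhat P γ (dist xhat (proj P xhat)) L ∧ γ L = y ∧
      ∀ t ≤ dist xhat (proj P xhat), γ t = γ₀ t := by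
  have hp := hs.isNearestPoint P hP xhat
  obtain ⟨σ, hσ, hσ0, hσ1, hσP⟩ := hs.treeGraded.geodesicSub P hP _ hp.1 y hy
  set p := proj P xhat
  have hD : 0 < dist p y := dist_pos.2 hne.symm
  have hglue : γ₀ (dist xhat p) = σ 0 := h1.trans hσ0.symm
  have hl : 0 ≤ dist xhat p := dist_nonneg
  refine ⟨pathConcat γ₀ (dist xhat p) σ, dist xhat p + dist p y,
    ⟨hγ.concat hl hD.le hσ hglue ?_, ?_, hl, by linarith, fun t ht => ⟨fun htP => ?_, fun hlt => ?_⟩⟩,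
    ?_, fun t ht => pathConcat_of_le ht⟩
  · rw [h0, hσ1, hs.treeGraded.dist_eq_add hs.geodesic hP hp hy]
  · rw [pathConcat_of_le hl, h0]
  · by_contra! hlt
    rw [pathConcat_of_le hlt.le] at htP
    have d := hp.dist_le htP
    rw [← h0, hγ.dist_zero ⟨ht.1, hlt.le⟩, h0] at d
    exact d.not_gt hlt
  · rw [pathConcat_of_ge hglue hlt]
    exact hσP _ ⟨by linarith, by linarith [ht.2]⟩
  · rw [pathConcat_of_ge hglue (by linarith), add_sub_cancel_left, hσ1]

/-- The sum of the piece colors at the end of the geodesic exceeds that at the entry to `P`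
by the color in `P`. -/
theorem EntersPiece.sum_colors (h : EntersPiece xhat P γ l L)
    (hs : ColoringSetup X PX n r fr xhat proj cP) (hP : P ∈ PX) {S T : Finset (Set X)}
    (hS : (S : Set (Set X)) = {Q | Q ∈ PX ∧ cP Q (proj Q (γ l)) ≠ 0})
    (hT : (T : Set (Set X)) = {Q | Q ∈ PX ∧ cP Q (proj Q (γ L)) ≠ 0}) :
    ∑ Q ∈ T, (cP Q (proj Q (γ L)) : ℕ) = ∑ Q ∈ S, (cP Q (proj Q (γ l)) : ℕ) + cP P (γ L) := by
  classical
  have hS' : ∀ Q, Q ∈ S ↔ Q ∈ PX ∧ cP Q (proj Q (γ l)) ≠ 0 := fun Q => by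
    rw [← Finset.mem_coe, hS]; rfl
  have hT' : ∀ Q, Q ∈ T ↔ Q ∈ PX ∧ cP Q (proj Q (γ L)) ≠ 0 := fun Q => by
    rw [← Finset.mem_coe, hT]; rfl
  have hPS : P ∉ S := by
    rw [hS', hs.proj_of_mem hP h.entry_mem, h.entry_eq hs hP]
    exact fun h' => h'.2 (hs.color_base hP)
  have hproj := hs.proj_of_mem hP h.end_mem
  have hsub : T ⊆ insert P S := by
    intro Q hQ
    by_cases hQP : Q = P
    · exact hQP ▸ Finset.mem_insert_self _ _
    · have := (hT' Q).1 hQ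
      rw [h.proj_end hs hP this.1 hQP] at this
      exact Finset.mem_insert_of_mem ((hS' Q).2 this)
  rw [Finset.sum_subset hsub fun Q hQ hQT => ?_, Finset.sum_insert hPS, hproj, add_comm]
  · congr 1
    refine Finset.sum_congr rfl fun Q hQ => ?_
    rw [h.proj_end hs hP ((hS' Q).1 hQ).1 fun e => hPS (e ▸ hQ)]
  · have hQX : Q ∈ PX := by
      rcases Finset.mem_insert.1 hQ with rfl | hQ
      · exact hP
      · exact ((hS' Q).1 hQ).1
    by_contra hne
    exact hQT ((hT' Q).2 ⟨hQX, fun e => hne (by rw [e]; rfl)⟩)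

/-- The sum of the floor terms at the end of the geodesic is obtained from that at the entry to `P`
by letting the last component `[a, l]` contribute through its whole length. -/
theorem EntersPiece.sum_floor (h : EntersPiece xhat P γ l L)
    (hs : ColoringSetup X PX n r fr xhat proj cP) (hP : P ∈ PX) {ι κ : Type*} [Fintype ι]
    [DecidableEq ι] [Fintype κ] {a b : ι → ℝ} {a' b' : κ → ℝ}
    (hd : IsIntervalDecomp (betaSet PX r xhat proj cP γ l) a b)
    (hd' : IsIntervalDecomp (betaSet PX r xhat proj cP γ L) a' b') {i₀ : ι} (hi₀ : b i₀ = l) :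
    ∑ j, ⌊floorLen PX γ (a' j) (b' j) / (99 * fr)⌋₊ =
      ∑ i ∈ Finset.univ.erase i₀, ⌊floorLen PX γ (a i) (b i) / (99 * fr)⌋₊ +
        ⌊(l - a i₀) / (99 * fr)⌋₊ := by
  have hG := hs.treeGraded
  have hr := hs.rpos
  have hSl : betaSet PX r xhat proj cP γ l ⊆ Iic l := fun t ht => (mem_betaSet.1 ht).1.2
  have ha0 : 0 ≤ a i₀ := (mem_betaSet.1 (hd.subset i₀ ⟨le_rfl, hd.le i₀⟩)).1.1
  have hupd : ∀ m, l < m → m ≤ L →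
      ∑ i, ⌊floorLen PX γ (a i) (Function.update b i₀ m i) / (99 * fr)⌋₊ =
      ∑ i ∈ Finset.univ.erase i₀, ⌊floorLen PX γ (a i) (b i) / (99 * fr)⌋₊ +
        ⌊(l - a i₀) / (99 * fr)⌋₊ := by
    intro m hlm hmL
    rw [← Finset.sum_erase_add _ _ (Finset.mem_univ i₀), Function.update_self,
      h.floorLen_eq hG hP ha0 (hi₀ ▸ hd.le i₀) hlm hmL]
    congr 1
    refine Finset.sum_congr rfl fun i hi => ?_
    rw [Function.update_of_ne (Finset.ne_of_mem_erase hi)]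
  by_cases hy : γ L ∈ pieceComp r xhat proj cP P
  · rw [← hupd L h.lt le_rfl]
    refine hd'.sum_eq ?_ fun u v => ⌊floorLen PX γ u v / (99 * fr)⌋₊
    rw [h.betaSet_of_short hs hP hy]
    exact hd.update_last hSl hi₀ h.lt.le
  · have hlt := h.half_lt_of_long hs hP hy
    rw [← hupd (l + r / 2) (by linarith) hlt.le]
    have hdec := (hd.update_last hSl hi₀ (by linarith : l ≤ l + r / 2)).insert_point (L := L) (by
      rintro t (ht | ht)
      · exact (hSl ht).trans_lt h.lt
      · exact ht.2.trans_lt hlt)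
    rw [← h.betaSet_of_long hs hP hy] at hdec
    rw [hd'.sum_eq hdec fun u v => ⌊floorLen PX γ u v / (99 * fr)⌋₊, Fintype.sum_option]
    simp [floorLen_self hG]

theorem floor_div_eq_or {x y M : ℝ} (hM : 0 < M) (hx : 0 ≤ x) (hxy : x ≤ y) (hyx : y ≤ x + M) :
    ⌊y / M⌋₊ = ⌊x / M⌋₊ ∨ ⌊y / M⌋₊ = ⌊x / M⌋₊ + 1 := by
  have h1 : ⌊x / M⌋₊ ≤ ⌊y / M⌋₊ := Nat.floor_mono (by gcongr)
  have h2 : ⌊y / M⌋₊ ≤ ⌊x / M⌋₊ + 1 := by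
    rw [← Nat.floor_add_one (div_nonneg hx hM.le)]
    refine Nat.floor_mono ?_
    rw [div_add_one hM.ne']
    gcongr
  omega

/-- On `P \ {x_P}` the coloring `c*_X` differs from `c_P` by a constant. -/
theorem ColoringSetup.color_eq_or (hs : ColoringSetup X PX n r fr xhat proj cP)
    {cX : X → Fin (n + 1)}
    (hcX : ∀ (γ : ℝ → X) (L : ℝ), 0 ≤ L → IsGeodesicSegment γ 0 L → γ 0 = xhat →
      ColorValue PX r fr xhat proj cP γ L (cX (γ L))) (hP : P ∈ PX) :
    (∀ y ∈ P, y ≠ proj P xhat → cX y = cP P y + cX (proj P xhat)) ∨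
      (∀ y ∈ P, y ≠ proj P xhat → cX y = cP P y + cX (proj P xhat) + 1) := by
  obtain ⟨γ₀, hγ, h0, h1⟩ := hs.geodesic xhat (proj P xhat)
  set l := dist xhat (proj P xhat)
  have hl0 : 0 ≤ l := dist_nonneg
  obtain ⟨S, k, a, b, hS, hab, hU, hdisj, hv⟩ := hcX γ₀ l hl0 hγ h0
  have hd : IsIntervalDecomp (betaSet PX r xhat proj cP γ₀ l) a b := ⟨hab, hU, hdisj⟩
  have hlmem : l ∈ betaSet PX r xhat proj cP γ₀ l :=
    mem_betaSet.2 ⟨⟨hl0, le_rfl⟩, fun Q hQ h' => h'.2.not_ge (pieceEnd_le hQ.2.1)⟩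
  obtain ⟨i₀, hi⟩ := hd.exists_mem hlmem
  have hi₀ : b i₀ = l := le_antisymm
    (mem_betaSet.1 (hd.subset i₀ ⟨hd.le i₀, le_rfl⟩)).1.2 hi.2
  have ha0 : 0 ≤ a i₀ := (mem_betaSet.1 (hd.subset i₀ ⟨le_rfl, hd.le i₀⟩)).1.1
  have hr := hs.rpos
  have hrf := hs.rlefr
  obtain ⟨f1, f2, f3⟩ := hs.floorLen_bounds hγ h0 ha0 hi.1 (hi₀ ▸ hd.subset i₀)
  have key : ∀ y ∈ P, y ≠ proj P xhat → (cX y : ℕ) =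
      (∑ Q ∈ S, (cP Q (proj Q (γ₀ l)) : ℕ) + cP P y +
        (∑ i ∈ Finset.univ.erase i₀, ⌊floorLen PX γ₀ (a i) (b i) / (99 * fr)⌋₊ +
          ⌊(l - a i₀) / (99 * fr)⌋₊)) % (n + 1) := by
    intro y hy hne
    obtain ⟨γ, L, hE, rfl, hγγ₀⟩ := hs.exists_entersPiece hP hγ h0 h1 hy hne
    obtain ⟨T, k', a', b', hT, hab', hU', hdisj', hv'⟩ :=
      hcX γ L (hE.nonneg.trans hE.lt.le) hE.geod hE.start
    rw [← betaSet_congr hl0 fun t ht => hγγ₀ t ht.2] at hd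
    rw [← hγγ₀ l le_rfl] at hS
    rw [hv', hE.sum_colors hs hP hS hT, hE.sum_floor hs hP hd ⟨hab', hU', hdisj'⟩ hi₀,
      hγγ₀ l le_rfl]
    congr 3
    refine Finset.sum_congr rfl fun i _ => ?_
    have hbl : b i ≤ l := (mem_betaSet.1 (hd.subset i ⟨hd.le i, le_rfl⟩)).1.2
    rw [floorLen_congr fun t ht => hγγ₀ t (ht.2.trans hbl)]
  rw [h1, ← Finset.sum_erase_add _ _ (Finset.mem_univ i₀), hi₀] at hv
  refine (floor_div_eq_or (M := 99 * fr) (by linarith) f1 f2 (by linarith)).imp ?_ ?_ <;>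
    intro hδ y hy hne
  · apply Fin.ext
    rw [key y hy hne, Fin.val_add, hv, hδ, Nat.add_mod_mod, h1]
    congr 1; ring
  · apply Fin.ext
    rw [key y hy hne, Fin.val_add, Fin.val_add, hv, hδ, Nat.add_mod_mod, Fin.val_one', h1,
      ← Nat.add_mod]
    congr 1; ring

/-- Points of a chain starting from an isolated point coincide with it. -/
theorem IsDChain.eq_of_isolated {r : ℝ} {S : Set X} {x y : X} (h : IsDChain dist r S x y)
    (hiso : ∀ z ∈ S, z ≠ x → r ≤ dist x z) : y = x := by
  obtain ⟨m, c, h0, rfl, hS, hd⟩ := h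
  have : ∀ i ≤ m, c i = x := by
    intro i
    induction i with
    | zero => exact fun _ => h0
    | succ i ih =>
      intro hi
      by_contra hne
      have := hd i (by omega)
      rw [ih (by omega)] at this
      exact this.not_ge (hiso _ (hS _ hi) hne)
  exact this m le_rfl

/-- A chain between points other than an isolated point avoids the latter. -/
theorem IsDChain.diff_isolated {r : ℝ} {S : Set X} {x y p : X} (h : IsDChain dist r S x y)
    (hiso : ∀ z ∈ S, z ≠ p → r ≤ dist p z) (hx : x ≠ p) :
    IsDChain dist r (S \ {p}) x y := by
  obtain ⟨m, c, h0, hm, hS, hd⟩ := h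
  refine ⟨m, c, h0, hm, fun i hi => ⟨hS i hi, ?_⟩, hd⟩
  induction i with
  | zero => exact h0 ▸ hx
  | succ i ih =>
    intro e
    rw [mem_singleton_iff] at e
    have := hd i (by omega)
    rw [e, dist_comm] at this
    exact this.not_ge (hiso _ (hS _ (by omega)) (ih (by omega)))

/-- Monochromatic chains of `c_P` are `8 f(r)`-bounded. -/
theorem ColoringSetup.dist_le_of_chain (hs : ColoringSetup X PX n r fr xhat proj cP) (hP : P ∈ PX)
    (j : Fin (n + 1)) {x y : X} (h : IsDChain dist r {z | z ∈ P ∧ cP P z = j} x y) :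
    dist x y ≤ 8 * fr := by
  by_cases hj : j = 0
  · subst hj
    exact hs.zeroBounded P hP x y h
  · linarith [hs.nonzeroBounded P hP j hj x y h, hs.rpos, hs.rlefr]

end ColoringAlongPiece

/-- In the Setup, on `P \ {x_P}` the coloring `c*_X` differs from `c_P` by a constant
modulo `n + 1` (either `c*_X = c_P + c*_X(x_P)` or `c*_X = c_P + c*_X(x_P) + 1`).
In particular, in any piece `P` all `r`-components of each `c*_X`-color are
`8·f(r)`-bounded. -/
theorem cX_almost_equals_cP (X : Type*) [MetricSpace X] [CompleteSpace X]
    (PX : Set (Set X)) (n : ℕ) (r fr : ℝ) (xhat : X)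
    (proj : Set X → X → X) (cP : Set X → X → Fin (n + 1))
    (hsetup : ColoringSetup X PX n r fr xhat proj cP)
    (cX : X → Fin (n + 1))
    (hcX : ∀ (γ : ℝ → X) (L : ℝ), 0 ≤ L → IsGeodesicSegment γ 0 L → γ 0 = xhat →
      ColorValue PX r fr xhat proj cP γ L (cX (γ L)))
    (P : Set X) (hP : P ∈ PX) :
    ((∀ y ∈ P, y ≠ proj P xhat → cX y = cP P y + cX (proj P xhat)) ∨
      (∀ y ∈ P, y ≠ proj P xhat → cX y = cP P y + cX (proj P xhat) + 1)) ∧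
    ∀ (j : Fin (n + 1)) (x y : X),
      IsDChain dist r {z : X | z ∈ P ∧ cX z = j} x y → dist x y ≤ 8 * fr := by
  have hmain := hsetup.color_eq_or hcX hP
  refine ⟨hmain, fun j x y hchain => ?_⟩
  set p := proj P xhat
  have hpcol : cP P p = 0 := hsetup.color_base hP
  rcases hmain with h | h
  · refine hsetup.dist_le_of_chain hP (j - cX p) (hchain.mono fun z hz => ⟨hz.1, ?_⟩)
    rw [← hz.2]
    by_cases hzp : z = p
    · rw [hzp, hpcol, sub_self]
    · rw [h z hz.1 hzp, add_sub_cancel_right]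
  · have hcol : ∀ z ∈ P, cX z = j → z ≠ p → cP P z = j - (cX p + 1) := by
      intro z hz hzj hzp
      rw [← hzj, h z hz hzp, add_assoc, add_sub_cancel_right]
    by_cases hj : j = cX p
    · have hne : j - (cX p + 1) ≠ 0 := by
        obtain ⟨k, rfl⟩ := Nat.exists_eq_succ_of_ne_zero hsetup.npos.ne'
        simp [hj]
      have hiso : ∀ z ∈ {z | z ∈ P ∧ cX z = j}, z ≠ p → r ≤ dist p z := by
        intro z hz hzp
        by_contra! hlt
        refine hne ?_
        rw [← hcol z hz.1 hz.2 hzp]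
        exact hsetup.ballZero P hP z hz.1 (by rw [dist_comm]; linarith [hsetup.rpos])
      by_cases hx : x = p
      · rw [hx] at hchain
        rw [hx, hchain.eq_of_isolated hiso, dist_self]
        linarith [hsetup.rpos, hsetup.rlefr]
      · exact hsetup.dist_le_of_chain hP _ ((hchain.diff_isolated hiso hx).mono
          fun z hz => ⟨hz.1.1, hcol z hz.1.1 hz.1.2 hz.2⟩)
    · refine hsetup.dist_le_of_chain hP _ (hchain.mono fun z hz => ⟨hz.1, hcol z hz.1 hz.2 ?_⟩)
      rintro rfl
      exact hj hz.2.symm
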